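/- For every T > 0 and constants C_σ ≥ 1, C_ν ≥ 1 there exists a constant C_SGD > 1 (depending only on C_σ, C_ν and T) with the following property. Let n ≥ 1, K ≤ nT a natural number, data points x_1 = (z_1,y_1), …, x_K = (z_K,y_K) ∈ ℝ^{d'}×ℝ, ν_0 a probability measure on ℝ×ℝ^{d'} supported in the closed ball of radius C_ν centered at 0, ν_k := (SGD^{x_k, ν_{k−1}})_* ν_{k−1}, θ_0 with ‖θ_0‖ ≤ C_ν and θ_k := θ_{k−1} + (1/n)·A(x_k, θ_{k−1}; ν_{k−1}) for 1 ≤ k ≤ K. Then (1/n)·Σ_{k=1}^{K} ‖A(x_k, θ_{k−1}; ν_{k−1})‖ ≤ C_SGD·(T²+1)·(1 + (1/n)·Σ_{i=1}^{K}|y_i|⁴ + (1/n)·Σ_{i=1}^{K}(1+‖z_i‖²)). -/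

import Mathlib

open MeasureTheory ProbabilityTheory Real Set Filter
open scoped ENNReal NNReal InnerProductSpace Topology

noncomputable section

attribute [local instance] MeasureTheory.Measure.Subtype.measureSpace

/-- Parameters `(c, w) ∈ ℝ × ℝ^{d'}`. -/
abbrev Param (d' : ℕ) := ℝ × EuclideanSpace ℝ (Fin d')
/-- Data points `(z, y) ∈ ℝ^{d'} × ℝ`. -/
abbrev Data (d' : ℕ) := EuclideanSpace ℝ (Fin d') × ℝ

/-- The network output `F(z, μ) = ∫ c·σ(zᵀw) dμ(c,w)`. -/
def netF {d' : ℕ} (σ : ℝ → ℝ) (z : EuclideanSpace ℝ (Fin d'))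
    (μ : Measure (Param d')) : ℝ :=
  ∫ p, p.1 * σ ⟪z, p.2⟫_ℝ ∂μ

/-- `g((z,y), μ) = y − F(z, μ)`. -/
def lossG {d' : ℕ} (σ : ℝ → ℝ) (x : Data d') (μ : Measure (Param d')) : ℝ :=
  x.2 - netF σ x.1 μ

/-- The gradient `A((z,y), (c,w); μ)`. -/
def gradA {d' : ℕ} (σ : ℝ → ℝ) (x : Data d') (θ : Param d')
    (μ : Measure (Param d')) : Param d' :=
  (lossG σ x μ * σ ⟪x.1, θ.2⟫_ℝ, (lossG σ x μ * θ.1 * deriv σ ⟪x.1, θ.2⟫_ℝ) • x.1)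

/-- Euclidean norm on parameters `ℝ × ℝ^{d'}`. -/
def pnorm {d' : ℕ} (θ : Param d') : ℝ := Real.sqrt (θ.1 ^ 2 + ‖θ.2‖ ^ 2)

/-- Euclidean norm on data points `ℝ^{d'} × ℝ`. -/
def dnorm {d' : ℕ} (x : Data d') : ℝ := Real.sqrt (‖x.1‖ ^ 2 + x.2 ^ 2)

/-- The SGD update map `SGD^{x,μ}(c,w) = (c,w) + (1/n)·A(x,(c,w);μ)`. -/
def sgdStep {d' : ℕ} (n : ℕ) (σ : ℝ → ℝ) (x : Data d')
    (μ : Measure (Param d')) (θ : Param d') : Param d' :=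
  θ + (n : ℝ)⁻¹ • gradA σ x θ μ

theorem aux_sum_Icc (f : ℕ → ℝ) (K : ℕ) :
    ∑ i ∈ Finset.Icc 1 K, f i = ∑ k ∈ Finset.range K, f (k + 1) := by
  induction K with
  | zero => simp
  | succ K ih => rw [Finset.sum_Icc_succ_top (by omega), ih, Finset.sum_range_succ]

theorem aux_fst_le {d' : ℕ} (p : Param d') : |p.1| ≤ pnorm p := by
  unfold pnorm
  apply Real.abs_le_sqrt
  nlinarith [sq_nonneg ‖p.2‖]

theorem aux_pnorm_le {d' : ℕ} (p : Param d') : pnorm p ≤ |p.1| + ‖p.2‖ := by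
  unfold pnorm
  apply Real.sqrt_le_iff.2
  constructor
  · positivity
  · nlinarith [sq_abs p.1, mul_nonneg (abs_nonneg p.1) (norm_nonneg p.2)]

theorem aux_lossG {d' : ℕ} (σ : ℝ → ℝ) (C M : ℝ) (hC : 0 ≤ C) (hσ : ∀ u, |σ u| ≤ C)
    (x : Data d') (μ : Measure (Param d')) [IsProbabilityMeasure μ]
    (h : ∀ᵐ p ∂μ, |p.1| ≤ M) : |lossG σ x μ| ≤ |x.2| + C * M := by
  have h1 : ‖∫ p, p.1 * σ ⟪x.1, p.2⟫_ℝ ∂μ‖ ≤ (C * M) * μ.real univ := by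
    apply norm_integral_le_of_norm_le_const
    filter_upwards [h] with p hp
    rw [norm_mul, Real.norm_eq_abs, Real.norm_eq_abs, mul_comm]
    exact mul_le_mul (hσ _) hp (abs_nonneg _) hC
  rw [probReal_univ, mul_one, Real.norm_eq_abs] at h1
  unfold lossG netF
  exact (abs_sub _ _).trans (by linarith)

theorem aux_meas {d' : ℕ} (n : ℕ) (σ : ℝ → ℝ) (hσ : Differentiable ℝ σ) (x : Data d')
    (μ : Measure (Param d')) : Measurable (sgdStep n σ x μ) := by
  have h1 : Measurable σ := hσ.continuous.measurable
  have h2 : Measurable (deriv σ) := measurable_deriv σ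
  have h3 : Measurable (fun θ : Param d' => ⟪x.1, θ.2⟫_ℝ) := by fun_prop
  have h4 := h1.comp h3
  have h5 := h2.comp h3
  simp only [Function.comp_def] at h4 h5
  unfold sgdStep gradA
  have h6 : Measurable (fun θ : Param d' => ((lossG σ x μ * σ ⟪x.1, θ.2⟫_ℝ,
      (lossG σ x μ * θ.1 * deriv σ ⟪x.1, θ.2⟫_ℝ) • x.1) : Param d')) := by
    refine Measurable.prodMk ?_ ?_
    · exact h4.const_mul _
    · exact ((measurable_fst.const_mul _).mul h5).smul_const _
  exact measurable_id.add (h6.const_smul ((n : ℝ)⁻¹))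

theorem aux_step {d' : ℕ} (n : ℕ) (σ : ℝ → ℝ) (C M : ℝ) (hC : 0 ≤ C) (hσ : ∀ u, |σ u| ≤ C)
    (x : Data d') (μ : Measure (Param d')) [IsProbabilityMeasure μ]
    (h : ∀ᵐ p ∂μ, |p.1| ≤ M) (θ : Param d') (hθ : |θ.1| ≤ M) :
    |(θ + (n : ℝ)⁻¹ • gradA σ x θ μ).1| ≤ M + (n : ℝ)⁻¹ * ((|x.2| + C * M) * C) := by
  have hg := aux_lossG σ C M hC hσ x μ h
  simp only [gradA, Prod.fst_add, Prod.smul_fst, smul_eq_mul]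
  refine (abs_add_le _ _).trans (add_le_add hθ ?_)
  rw [abs_mul, abs_mul, abs_of_nonneg (by positivity : (0:ℝ) ≤ (n : ℝ)⁻¹)]
  apply mul_le_mul_of_nonneg_left _ (by positivity)
  exact mul_le_mul hg (hσ _) (abs_nonneg _) ((abs_nonneg _).trans hg)

theorem aux_term (C M y z : ℝ) (hC : 1 ≤ C) (hM : 1 ≤ M) (hy : 0 ≤ y) (hz : 0 ≤ z) :
    (y + C * M) * (C + M * C * z) ≤ C ^ 2 * (2 * M ^ 4 + y ^ 4 + (1 + z ^ 2)) := by
  have h1 : y + C * M ≤ C * (y + M) := by nlinarith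
  have h2 : C + M * C * z ≤ C * (M * (1 + z)) := by nlinarith
  have h3 : (y + M) * (M * (1 + z)) ≤ 2 * M ^ 4 + y ^ 4 + (1 + z ^ 2) := by
    nlinarith [sq_nonneg (M * (y + M) - (1 + z)), sq_nonneg (M ^ 2 - y ^ 2), sq_nonneg (1 - z),
      mul_nonneg (sq_nonneg M) (sq_nonneg (y - M)), sq_nonneg (y ^ 2), sq_nonneg (M^2)]
  calc (y + C * M) * (C + M * C * z) ≤ (C * (y + M)) * (C * (M * (1 + z))) := by
        apply mul_le_mul h1 h2 <;> positivity
    _ = C ^ 2 * ((y + M) * (M * (1 + z))) := by ring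
    _ ≤ _ := by gcongr

theorem aux_grad {d' : ℕ} (σ : ℝ → ℝ) (C M : ℝ) (hC : 1 ≤ C) (hM : 1 ≤ M) (hσ : ∀ u, |σ u| ≤ C)
    (hσ' : ∀ u, |deriv σ u| ≤ C)
    (x : Data d') (μ : Measure (Param d')) [IsProbabilityMeasure μ]
    (h : ∀ᵐ p ∂μ, |p.1| ≤ M) (θ : Param d') (hθ : |θ.1| ≤ M) :
    pnorm (gradA σ x θ μ) ≤ C ^ 2 * (2 * M ^ 4 + |x.2| ^ 4 + (1 + ‖x.1‖ ^ 2)) := by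
  have hg := aux_lossG σ C M (by linarith) hσ x μ h
  refine le_trans ?_ (aux_term C M |x.2| ‖x.1‖ hC hM (abs_nonneg _) (norm_nonneg _))
  refine (aux_pnorm_le _).trans ?_
  simp only [gradA, norm_smul, abs_mul, Real.norm_eq_abs]
  have e : |lossG σ x μ| * |σ ⟪x.1, θ.2⟫_ℝ| + |lossG σ x μ| * |θ.1| * |deriv σ ⟪x.1, θ.2⟫_ℝ| * ‖x.1‖
    = |lossG σ x μ| * (|σ ⟪x.1, θ.2⟫_ℝ| + |θ.1| * |deriv σ ⟪x.1, θ.2⟫_ℝ| * ‖x.1‖) := by ring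
  rw [e]
  gcongr
  · exact hσ _
  · exact hσ' _

/-- uniform bound on the average size of the SGD update steps. -/
theorem sgd_average_update_bound (T Cσ Cν : ℝ) (hT : 0 < T) (hCσ : 1 ≤ Cσ) (hCν : 1 ≤ Cν) :
    ∃ CSGD : ℝ, 1 < CSGD ∧
      ∀ (d' : ℕ) (σ : ℝ → ℝ), Differentiable ℝ σ → (∀ u, |σ u| ≤ Cσ) →
        (∀ u, |deriv σ u| ≤ Cσ) →
      ∀ (n K : ℕ), 1 ≤ n → (K : ℝ) ≤ n * T →
      ∀ (x : ℕ → Data d') (ν : ℕ → Measure (Param d')) (θ : ℕ → Param d'),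
        IsProbabilityMeasure (ν 0) → (∀ᵐ p ∂(ν 0), pnorm p ≤ Cν) →
        (∀ k < K, ν (k + 1) = (ν k).map (sgdStep n σ (x (k + 1)) (ν k))) →
        pnorm (θ 0) ≤ Cν →
        (∀ k < K, θ (k + 1) = θ k + (n : ℝ)⁻¹ • gradA σ (x (k + 1)) (θ k) (ν k)) →
        (n : ℝ)⁻¹ * ∑ k ∈ Finset.range K, pnorm (gradA σ (x (k + 1)) (θ k) (ν k)) ≤
          CSGD * (T ^ 2 + 1) *
            (1 + (n : ℝ)⁻¹ * ∑ i ∈ Finset.Icc 1 K, |(x i).2| ^ 4 +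
              (n : ℝ)⁻¹ * ∑ i ∈ Finset.Icc 1 K, (1 + ‖(x i).1‖ ^ 2)) := by
  set E := Real.exp (Cσ ^ 2 * T) with hE
  refine ⟨1 + Cσ ^ 2 * (1 + 16 * T * E ^ 4 * Cν ^ 4 + 16 * T ^ 4 * E ^ 4 * Cσ ^ 4), ?_, ?_⟩
  · have : 0 < Cσ ^ 2 * (1 + 16 * T * E ^ 4 * Cν ^ 4 + 16 * T ^ 4 * E ^ 4 * Cσ ^ 4) := by positivity
    linarith
  intro d' σ hd hσ hσ' n K hn hK x ν θ hp hν hνs hθ hθs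
  have hC0 : 0 ≤ Cσ := by linarith
  have hn0 : (0:ℝ) < n := by exact_mod_cast hn
  set a : ℕ → ℝ := fun k => (1 + (n:ℝ)⁻¹ * Cσ ^ 2) ^ k *
    (Cν + Cσ * ((n:ℝ)⁻¹ * ∑ i ∈ Finset.range k, |(x (i + 1)).2|)) with ha
  have hstep : ∀ k, a k + (n : ℝ)⁻¹ * ((|(x (k+1)).2| + Cσ * a k) * Cσ) ≤ a (k + 1) := by
    intro k
    have h1 : (1:ℝ) ≤ (1 + (n:ℝ)⁻¹ * Cσ ^ 2) ^ (k + 1) :=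
      one_le_pow₀ (by have : 0 ≤ (n:ℝ)⁻¹ * Cσ ^ 2 := by positivity
                      linarith)
    have h2 : a (k + 1) = (1 + (n:ℝ)⁻¹ * Cσ ^ 2) * a k +
        (1 + (n:ℝ)⁻¹ * Cσ ^ 2) ^ (k + 1) * ((n : ℝ)⁻¹ * |(x (k+1)).2| * Cσ) := by
      simp only [ha, Finset.sum_range_succ]
      ring
    have h3 : 0 ≤ (n : ℝ)⁻¹ * |(x (k+1)).2| * Cσ := by positivity
    rw [h2]
    nlinarith [mul_le_mul_of_nonneg_right h1 h3]
  have key : ∀ k, k ≤ K → IsProbabilityMeasure (ν k) ∧ (∀ᵐ p ∂(ν k), |p.1| ≤ a k) ∧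
      |(θ k).1| ≤ a k := by
    intro k
    induction k with
    | zero =>
      intro _
      have : a 0 = Cν := by simp [ha]
      rw [this]
      refine ⟨hp, ?_, (aux_fst_le _).trans hθ⟩
      filter_upwards [hν] with p h using (aux_fst_le _).trans h
    | succ k ih =>
      intro hk
      obtain ⟨i1, i2, i3⟩ := ih (by omega)
      have hm := aux_meas n σ hd (x (k + 1)) (ν k)
      rw [hνs k (by omega), hθs k (by omega)]
      refine ⟨Measure.isProbabilityMeasure_map hm.aemeasurable, ?_, ?_⟩
      · rw [ae_map_iff hm.aemeasurable (measurableSet_le (by fun_prop) (by fun_prop))]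
        filter_upwards [i2] with p h
        exact (aux_step n σ Cσ (a k) hC0 hσ (x (k+1)) (ν k) i2 p h).trans (hstep k)
      · exact (aux_step n σ Cσ (a k) hC0 hσ (x (k+1)) (ν k) i2 _ i3).trans (hstep k)
  set S := (n:ℝ)⁻¹ * ∑ i ∈ Finset.range K, |(x (i + 1)).2| with hS
  have hS0 : 0 ≤ S := by positivity
  set M := E * (Cν + Cσ * S) with hM
  have hE1 : 1 ≤ E := Real.one_le_exp (by positivity)
  have hM1 : 1 ≤ M := by
    have : 0 ≤ Cσ * S := by positivity
    nlinarith
  have haM : ∀ k, k ≤ K → a k ≤ M := by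
    intro k hk
    have h1 : (1 + (n:ℝ)⁻¹ * Cσ ^ 2) ^ k ≤ E := by
      calc (1 + (n:ℝ)⁻¹ * Cσ ^ 2) ^ k ≤ (Real.exp ((n:ℝ)⁻¹ * Cσ ^ 2)) ^ k := by
            gcongr
            linarith [Real.add_one_le_exp ((n:ℝ)⁻¹ * Cσ ^ 2)]
        _ = Real.exp (k * ((n:ℝ)⁻¹ * Cσ ^ 2)) := by rw [← Real.exp_nat_mul]
        _ ≤ E := by
            apply Real.exp_le_exp.2
            have : (k:ℝ) ≤ n * T := le_trans (by exact_mod_cast hk) hK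
            calc (k:ℝ) * ((n:ℝ)⁻¹ * Cσ ^ 2) ≤ (n * T) * ((n:ℝ)⁻¹ * Cσ ^ 2) := by gcongr
              _ = Cσ ^ 2 * T := by field_simp
    have h2 : ∑ i ∈ Finset.range k, |(x (i + 1)).2| ≤ ∑ i ∈ Finset.range K, |(x (i + 1)).2| :=
      Finset.sum_le_sum_of_subset_of_nonneg (Finset.range_mono hk) (fun _ _ _ => abs_nonneg _)
    simp only [ha, hM, hS]
    gcongr
  rw [aux_sum_Icc, aux_sum_Icc]
  set Y := (n:ℝ)⁻¹ * ∑ k ∈ Finset.range K, |(x (k + 1)).2| ^ 4 with hY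
  set Z := (n:ℝ)⁻¹ * ∑ k ∈ Finset.range K, (1 + ‖(x (k + 1)).1‖ ^ 2) with hZ
  have hY0 : 0 ≤ Y := by positivity
  have hZ0 : 0 ≤ Z := by positivity
  have hKn : (n:ℝ)⁻¹ * K ≤ T := by
    rw [inv_mul_le_iff₀ hn0]; exact hK
  have hS4 : S ^ 4 ≤ T ^ 3 * Y := by
    have h2 : (∑ i ∈ Finset.range K, |(x (i + 1)).2|) ^ 4 ≤
        (K:ℝ) ^ 3 * ∑ i ∈ Finset.range K, |(x (i + 1)).2| ^ 4 := by
      have h := sq_sum_le_card_mul_sum_sq (s := Finset.range K) (f := fun i => |(x (i + 1)).2|)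
      have h' := sq_sum_le_card_mul_sum_sq (s := Finset.range K) (f := fun i => |(x (i + 1)).2| ^ 2)
      simp only [Finset.card_range, ← pow_mul] at h h'
      norm_num only at h'
      calc (∑ i ∈ Finset.range K, |(x (i + 1)).2|) ^ 4
          = ((∑ i ∈ Finset.range K, |(x (i + 1)).2|) ^ 2) ^ 2 := by ring
        _ ≤ (K * ∑ i ∈ Finset.range K, |(x (i + 1)).2| ^ 2) ^ 2 := by gcongr
        _ = (K:ℝ) ^ 2 * (∑ i ∈ Finset.range K, |(x (i + 1)).2| ^ 2) ^ 2 := by ring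
        _ ≤ (K:ℝ) ^ 2 * (K * ∑ i ∈ Finset.range K, |(x (i + 1)).2| ^ 4) := by gcongr
        _ = _ := by ring
    calc S ^ 4 = ((n:ℝ)⁻¹) ^ 4 * (∑ i ∈ Finset.range K, |(x (i + 1)).2|) ^ 4 := by rw [hS]; ring
      _ ≤ ((n:ℝ)⁻¹) ^ 4 * ((K:ℝ) ^ 3 * ∑ i ∈ Finset.range K, |(x (i + 1)).2| ^ 4) := by gcongr
      _ = ((n:ℝ)⁻¹ * K) ^ 3 * Y := by rw [hY]; ring
      _ ≤ _ := by gcongr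
  have hM4 : M ^ 4 ≤ E ^ 4 * (8 * (Cν ^ 4 + Cσ ^ 4 * (T ^ 3 * Y))) := by
    have h1 : (Cν + Cσ * S) ^ 4 ≤ 8 * (Cν ^ 4 + (Cσ * S) ^ 4) := by
      have := add_pow_le (by linarith : 0 ≤ Cν) (by positivity : 0 ≤ Cσ * S) 4
      norm_num at this ⊢
      exact this
    rw [hM, mul_pow]
    gcongr
    refine h1.trans ?_
    rw [mul_pow]
    gcongr
  have hsum : (n : ℝ)⁻¹ * ∑ k ∈ Finset.range K, pnorm (gradA σ (x (k + 1)) (θ k) (ν k)) ≤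
      Cσ ^ 2 * (2 * M ^ 4 * T + Y + Z) := by
    calc (n : ℝ)⁻¹ * ∑ k ∈ Finset.range K, pnorm (gradA σ (x (k + 1)) (θ k) (ν k))
        ≤ (n : ℝ)⁻¹ * ∑ k ∈ Finset.range K, (Cσ ^ 2 * (2 * M ^ 4 + |(x (k+1)).2| ^ 4 +
            (1 + ‖(x (k+1)).1‖ ^ 2))) := by
          gcongr with k hk
          have hk' : k ≤ K := (Finset.mem_range.1 hk).le
          obtain ⟨i1, i2, i3⟩ := key k hk'
          refine aux_grad σ Cσ M hCσ hM1 hσ hσ' _ _ ?_ _ (i3.trans (haM k hk'))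
          filter_upwards [i2] with p h using h.trans (haM k hk')
      _ = Cσ ^ 2 * (2 * M ^ 4 * ((n:ℝ)⁻¹ * K) + Y + Z) := by
          rw [← Finset.mul_sum, Finset.sum_add_distrib, Finset.sum_add_distrib, Finset.sum_const,
            Finset.card_range, nsmul_eq_mul, hY, hZ]
          ring
      _ ≤ _ := by gcongr
  refine hsum.trans ?_
  set P := 16 * T * E ^ 4 * Cν ^ 4 with hP
  set Q := 16 * T ^ 4 * E ^ 4 * Cσ ^ 4 with hQ
  have hP0 : 0 ≤ P := by positivity
  have hQ0 : 0 ≤ Q := by positivity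
  calc Cσ ^ 2 * (2 * M ^ 4 * T + Y + Z)
      ≤ Cσ ^ 2 * (2 * (E ^ 4 * (8 * (Cν ^ 4 + Cσ ^ 4 * (T ^ 3 * Y)))) * T + Y + Z) := by gcongr
    _ = Cσ ^ 2 * (P + Q * Y + Y + Z) := by rw [hP, hQ]; ring
    _ ≤ Cσ ^ 2 * ((1 + P + Q) * (1 + Y + Z)) := by
        gcongr
        nlinarith [mul_nonneg hP0 hY0, mul_nonneg hP0 hZ0, mul_nonneg hQ0 hZ0]
    _ ≤ (1 + Cσ ^ 2 * (1 + P + Q)) * 1 * (1 + Y + Z) := by nlinarith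
    _ ≤ _ := by
        have : 0 ≤ T ^ 2 := by positivity
        gcongr
        linarith
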